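/- Assume p > d. Let x₀ ∈ ℝ^d, let r > 0, let V ∈ L^∞(B(x₀,r)∖{x₀}), and let v ∈ C¹(B(x₀,r)∖{x₀}) be a positive weak solution of Q'(u) = 0 in the punctured ball B(x₀,r)∖{x₀} for which there exist constants 0 < c ≤ C with c ≤ v(x) ≤ C for all x in some punctured neighborhood of x₀. Then v can be continuously extended at x₀, i.e., the limit lim_{x→x₀} v(x) exists. -/

import Mathlib

open MeasureTheory Filter Set Metric
open scoped RealInnerProductSpace Topology NNReal

noncomputable section

abbrev Ed (d : ℕ) : Type := EuclideanSpace ℝ (Fin d)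

/-- `u ∈ C_c^∞(Ω)`: a smooth function compactly supported inside `Ω`. -/
def IsTestFun {d : ℕ} (Ω : Set (Ed d)) (u : Ed d → ℝ) : Prop :=
  ContDiff ℝ (⊤ : ℕ∞) u ∧ HasCompactSupport u ∧ tsupport u ⊆ Ω

/-- `V ∈ L^∞_loc(Ω)`. -/
def LinfLoc {d : ℕ} (Ω : Set (Ed d)) (V : Ed d → ℝ) : Prop :=
  Measurable V ∧ ∀ K : Set (Ed d), IsCompact K → K ⊆ Ω → ∃ C : ℝ, ∀ x ∈ K, |V x| ≤ C

/-- The energy functional `Q(u) = (1/p) ∫_Ω (|∇u|^p + V|u|^p)`. -/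
def Qf {d : ℕ} (p : ℝ) (V : Ed d → ℝ) (Ω : Set (Ed d)) (u : Ed d → ℝ) : ℝ :=
  (1 / p) * ∫ x in Ω, (‖gradient u x‖ ^ p + V x * |u x| ^ p)

/-- Weak solution of `Q'(u) = -Δ_p u + V|u|^{p-2}u = 0` in `Ω'`. -/
def IsSolution {d : ℕ} (p : ℝ) (V : Ed d → ℝ) (Ω' : Set (Ed d)) (v : Ed d → ℝ) : Prop :=
  ∀ φ : Ed d → ℝ, IsTestFun Ω' φ →
    ∫ x in Ω', (‖gradient v x‖ ^ (p - 2) * ⟪gradient v x, gradient φ x⟫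
      + V x * |v x| ^ (p - 2) * v x * φ x) = 0

/-- Weak supersolution of `Q'(u) = 0` in `Ω'`. -/
def IsSupersolution {d : ℕ} (p : ℝ) (V : Ed d → ℝ) (Ω' : Set (Ed d)) (v : Ed d → ℝ) : Prop :=
  ∀ φ : Ed d → ℝ, IsTestFun Ω' φ → (∀ x, 0 ≤ φ x) →
    0 ≤ ∫ x in Ω', (‖gradient v x‖ ^ (p - 2) * ⟪gradient v x, gradient φ x⟫
      + V x * |v x| ^ (p - 2) * v x * φ x)

/-- Weak subsolution of `Q'(u) = 0` in `Ω'`. -/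
def IsSubsolution {d : ℕ} (p : ℝ) (V : Ed d → ℝ) (Ω' : Set (Ed d)) (v : Ed d → ℝ) : Prop :=
  ∀ φ : Ed d → ℝ, IsTestFun Ω' φ → (∀ x, 0 ≤ φ x) →
    ∫ x in Ω', (‖gradient v x‖ ^ (p - 2) * ⟪gradient v x, gradient φ x⟫
      + V x * |v x| ^ (p - 2) * v x * φ x) ≤ 0


section Morrey

open Module

variable {E : Type*} [NormedAddCommGroup E] [NormedSpace ℝ E]

theorem add_smul_sub_mem_ball {a x z : E} {ρ t : ℝ} (hx : x ∈ ball a ρ) (hz : z ∈ ball a ρ)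
    (ht : t ∈ Icc (0 : ℝ) 1) : x + t • (z - x) ∈ ball a ρ :=
  (convex_ball a ρ).add_smul_sub_mem hx hz ht

theorem enorm_sub_le_lintegral_fderiv_of_contDiffOn_ball {g : E → ℝ} {a x z : E} {ρ : ℝ}
    (hg : ContDiffOn ℝ 1 g (ball a ρ)) (hx : x ∈ ball a ρ) (hz : z ∈ ball a ρ) :
    ‖g z - g x‖ₑ ≤ ∫⁻ t in Ioc (0 : ℝ) 1,
      ENNReal.ofReal (2 * ρ) * ‖fderiv ℝ g (x + t • (z - x))‖ₑ := by
  set l : ℝ → E := fun t => x + t • (z - x) with hl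
  have hlc : ContDiff ℝ 1 l := by fun_prop
  have hmem : ∀ t ∈ Icc (0 : ℝ) 1, l t ∈ ball a ρ := fun t ht => add_smul_sub_mem_ball hx hz ht
  have h1 : ContDiffOn ℝ 1 (g ∘ l) (Icc 0 1) := hg.comp hlc.contDiffOn hmem
  have h2 := enorm_sub_le_lintegral_deriv_of_contDiffOn_Icc h1 zero_le_one
  have e0 : l 0 = x := by simp [hl]
  have e1 : l 1 = z := by simp [hl]
  simp only [Function.comp, e0, e1] at h2
  refine h2.trans ?_
  rw [restrict_Ioc_eq_restrict_Icc]
  refine setLIntegral_mono' measurableSet_Icc fun t ht => ?_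
  have hd : HasDerivAt l (z - x) t := by
    have h := ((hasDerivAt_id t).smul_const (z - x)).const_add x
    rwa [one_smul] at h
  have hgd : DifferentiableAt ℝ g (l t) :=
    (hg.contDiffAt (isOpen_ball.mem_nhds (hmem t ht))).differentiableAt one_ne_zero
  have h3 : deriv (g ∘ l) t = _ := (hgd.hasFDerivAt.comp_hasDerivAt t hd).deriv
  rw [h3, mul_comm]
  refine (ContinuousLinearMap.le_opENorm _ _).trans ?_
  gcongr
  rw [← ofReal_norm]
  refine ENNReal.ofReal_le_ofReal ?_
  rw [← dist_eq_norm]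
  have := dist_triangle_right z x a
  have h4 := mem_ball.1 hx
  have h5 := mem_ball.1 hz
  linarith

variable [FiniteDimensional ℝ E] [MeasurableSpace E] [BorelSpace E]
  (μ : Measure E) [μ.IsAddHaarMeasure]

theorem setLIntegral_ball_comp_add_smul_sub_le {a x : E} {ρ t : ℝ} (hx : x ∈ ball a ρ)
    (ht : t ∈ Ioc (0 : ℝ) 1) {F : E → ENNReal} (hF : Measurable F) :
    ∫⁻ z in ball a ρ, F (x + t • (z - x)) ∂μ
      ≤ ENNReal.ofReal ((t ^ finrank ℝ E)⁻¹) * ∫⁻ z in ball a ρ, F z ∂μ := by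
  set T : E → E := fun z => x + t • (z - x) with hT
  have hTm : Measurable T := by fun_prop
  have hmap : μ.map T = ENNReal.ofReal ((t ^ finrank ℝ E)⁻¹) • μ := by
    have h1 : T = (fun z => (x - t • x) + z) ∘ (fun z => t • z) := by
      ext z; simp only [hT, Function.comp, smul_sub]; abel
    rw [h1, ← Measure.map_map (by fun_prop) (by fun_prop), Measure.map_addHaar_smul μ ht.1.ne',
      Measure.map_smul, map_add_left_eq_self, abs_of_pos (by have := ht.1; positivity)]
  calc ∫⁻ z in ball a ρ, F (T z) ∂μ ≤ ∫⁻ z in T ⁻¹' ball a ρ, F (T z) ∂μ :=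
        lintegral_mono_set fun z hz => add_smul_sub_mem_ball hx hz ⟨ht.1.le, ht.2⟩
    _ = ∫⁻ z in ball a ρ, F z ∂(μ.map T) :=
        (setLIntegral_map measurableSet_ball hF hTm).symm
    _ = _ := by rw [hmap, Measure.restrict_smul, lintegral_smul_measure, smul_eq_mul]

theorem lintegral_Ioc_ofReal_rpow {s : ℝ} (hs : -1 < s) :
    ∫⁻ t in Ioc (0 : ℝ) 1, ENNReal.ofReal (t ^ s) = ENNReal.ofReal (1 / (s + 1)) := by
  rw [← ofReal_integral_eq_lintegral_ofReal]
  · rw [← intervalIntegral.integral_of_le zero_le_one, integral_rpow (Or.inl hs)]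
    simp [Real.zero_rpow (by linarith : s + 1 ≠ 0)]
  · exact (intervalIntegrable_iff_integrableOn_Ioc_of_le zero_le_one).1
      (intervalIntegral.intervalIntegrable_rpow' hs)
  · filter_upwards [self_mem_ae_restrict measurableSet_Ioc] with t ht
    exact Real.rpow_nonneg ht.1.le _

/-- The oscillation of `g` about the value at a point of a ball, integrated over that ball. -/
theorem lintegral_enorm_sub_le_of_contDiffOn_ball {p q : ℝ} (hpq : p.HolderConjugate q)
    (hp : (finrank ℝ E : ℝ) < p) {g : E → ℝ} {a x : E} {ρ : ℝ}
    (hg : ContDiffOn ℝ 1 g (ball a ρ)) (hx : x ∈ ball a ρ) :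
    ∫⁻ z in ball a ρ, ‖g z - g x‖ₑ ∂μ ≤
      ENNReal.ofReal (2 * ρ) * ENNReal.ofReal (p / (p - finrank ℝ E)) *
        (∫⁻ z in ball a ρ, ‖fderiv ℝ g z‖ₑ ^ p ∂μ) ^ (1 / p) * μ (ball a ρ) ^ (1 / q) := by
  set n := finrank ℝ E with hn
  set J := ∫⁻ z in ball a ρ, ‖fderiv ℝ g z‖ₑ ^ p ∂μ with hJ
  have hp0 : 0 < p := hpq.pos
  have hFm : Measurable fun z => ‖fderiv ℝ g z‖ₑ := (measurable_fderiv ℝ g).enorm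
  have hslice : ∀ t ∈ Ioc (0 : ℝ) 1, ∫⁻ z in ball a ρ, ‖fderiv ℝ g (x + t • (z - x))‖ₑ ∂μ ≤
      ENNReal.ofReal (t ^ (-(n / p))) * (J ^ (1 / p) * μ (ball a ρ) ^ (1 / q)) := by
    intro t ht
    have h1 := ENNReal.lintegral_mul_le_Lp_mul_Lq (μ.restrict (ball a ρ)) hpq
      (f := fun z => ‖fderiv ℝ g (x + t • (z - x))‖ₑ) (g := fun _ => 1)
      (hFm.comp (by fun_prop)).aemeasurable aemeasurable_const
    simp only [Pi.mul_apply, mul_one, ENNReal.one_rpow, lintegral_one,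
      Measure.restrict_apply MeasurableSet.univ, univ_inter] at h1
    refine h1.trans ?_
    rw [← mul_assoc]
    gcongr
    calc (∫⁻ z in ball a ρ, ‖fderiv ℝ g (x + t • (z - x))‖ₑ ^ p ∂μ) ^ (1 / p)
        ≤ (ENNReal.ofReal ((t ^ n)⁻¹) * J) ^ (1 / p) := by
          gcongr
          exact setLIntegral_ball_comp_add_smul_sub_le μ hx ht (hFm.pow_const p)
      _ = _ := by
          rw [ENNReal.mul_rpow_of_nonneg _ _ (by positivity)]
          congr 1
          rw [ENNReal.ofReal_rpow_of_pos (by have := ht.1; positivity)]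
          congr 1
          rw [← Real.rpow_natCast, ← Real.rpow_neg ht.1.le, ← Real.rpow_mul ht.1.le]
          congr 1
          field_simp
  calc ∫⁻ z in ball a ρ, ‖g z - g x‖ₑ ∂μ
      ≤ ∫⁻ z in ball a ρ, (∫⁻ t in Ioc (0 : ℝ) 1,
          ENNReal.ofReal (2 * ρ) * ‖fderiv ℝ g (x + t • (z - x))‖ₑ) ∂μ :=
        setLIntegral_mono' measurableSet_ball fun z hz =>
          enorm_sub_le_lintegral_fderiv_of_contDiffOn_ball hg hx hz
    _ = ∫⁻ t in Ioc (0 : ℝ) 1, (∫⁻ z in ball a ρ,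
          ENNReal.ofReal (2 * ρ) * ‖fderiv ℝ g (x + t • (z - x))‖ₑ ∂μ) := by
        refine lintegral_lintegral_swap (Measurable.aemeasurable ?_)
        refine Measurable.const_mul (hFm.comp ?_) _
        fun_prop
    _ ≤ ∫⁻ t in Ioc (0 : ℝ) 1, ENNReal.ofReal (t ^ (-(n / p))) *
          (ENNReal.ofReal (2 * ρ) * (J ^ (1 / p) * μ (ball a ρ) ^ (1 / q))) := by
        refine setLIntegral_mono' measurableSet_Ioc fun t ht => ?_
        rw [lintegral_const_mul' _ _ ENNReal.ofReal_ne_top, mul_left_comm]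
        gcongr
        exact hslice t ht
    _ = _ := by
        rw [lintegral_mul_const _ (by fun_prop), lintegral_Ioc_ofReal_rpow
          (by rw [neg_lt_neg_iff, div_lt_one hp0]; exact hp)]
        have : 1 / (-((n : ℝ) / p) + 1) = p / (p - n) := by
          have : p - n ≠ 0 := by linarith
          have h2 : -((n : ℝ) / p) + 1 = (p - n) / p := by field_simp; ring
          rw [h2, one_div_div]
        rw [this]
        ring

/-- **Morrey's inequality** on balls. -/
theorem exists_morrey_ball {p : ℝ} (hp1 : 1 < p) (hp : (finrank ℝ E : ℝ) < p) :
    ∃ C : ℝ, 0 ≤ C ∧ ∀ (g : E → ℝ) (a : E) (ρ I : ℝ), 0 < ρ → 0 ≤ I →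
      ContDiffOn ℝ 1 g (ball a ρ) →
      ∫⁻ z in ball a ρ, ‖fderiv ℝ g z‖ₑ ^ p ∂μ ≤ ENNReal.ofReal I →
      ∀ x ∈ ball a ρ, ∀ y ∈ ball a ρ,
        |g x - g y| ≤ C * ρ ^ (1 - finrank ℝ E / p) * I ^ (1 / p) := by
  set n := finrank ℝ E with hn
  set ω := μ.real (ball 0 1) with hω
  have hω0 : 0 < ω := ENNReal.toReal_pos (measure_ball_pos μ _ one_pos).ne' measure_ball_lt_top.ne
  have hp0 : 0 < p := by linarith
  have hpn : 0 < p - n := by linarith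
  refine ⟨4 * (p / (p - n)) * ω ^ (-(1 / p)), by positivity, ?_⟩
  intro g a ρ I hρ hI hg hJ x hx y hy
  obtain ⟨q, hpq⟩ : ∃ q, p.HolderConjugate q := ⟨_, Real.HolderConjugate.conjExponent hp1⟩
  have hvol : μ (ball a ρ) = ENNReal.ofReal (ρ ^ n * ω) := by
    rw [Measure.addHaar_ball_of_pos μ a hρ, ENNReal.ofReal_mul (by positivity), hω, measureReal_def,
      ENNReal.ofReal_toReal measure_ball_lt_top.ne]
  set W := ρ ^ n * ω with hW
  have hW0 : 0 < W := by positivity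
  have key : ∀ x ∈ ball a ρ, ∫⁻ z in ball a ρ, ‖g z - g x‖ₑ ∂μ ≤
      ENNReal.ofReal (2 * ρ * (p / (p - n)) * I ^ (1 / p) * W ^ (1 / q)) := by
    intro x hx
    refine (lintegral_enorm_sub_le_of_contDiffOn_ball μ hpq hp hg hx).trans ?_
    rw [ENNReal.ofReal_mul (by positivity), ENNReal.ofReal_mul (by positivity),
      ENNReal.ofReal_mul (by positivity), hvol, ENNReal.ofReal_rpow_of_pos hW0,
      ← ENNReal.ofReal_rpow_of_nonneg hI (by positivity), ← hn]
    gcongr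
    rw [← ENNReal.ofReal_mul (by positivity), ← ENNReal.ofReal_mul (by positivity)]
  have h1 : ENNReal.ofReal (|g x - g y| * W) ≤
      ENNReal.ofReal (2 * (2 * ρ * (p / (p - n)) * I ^ (1 / p) * W ^ (1 / q))) := by
    calc ENNReal.ofReal (|g x - g y| * W) = ∫⁻ z in ball a ρ, ‖g x - g y‖ₑ ∂μ := by
          rw [setLIntegral_const, hvol, ENNReal.ofReal_mul (abs_nonneg _), ← Real.norm_eq_abs,
            ofReal_norm]
      _ ≤ ∫⁻ z in ball a ρ, (‖g z - g y‖ₑ + ‖g z - g x‖ₑ) ∂μ := by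
          refine lintegral_mono fun z => ?_
          have : g x - g y = (g z - g y) - (g z - g x) := by ring
          rw [this]
          exact enorm_sub_le
      _ = ∫⁻ z in ball a ρ, ‖g z - g y‖ₑ ∂μ + ∫⁻ z in ball a ρ, ‖g z - g x‖ₑ ∂μ := by
          refine lintegral_add_left' ?_ _
          exact ((hg.continuousOn.sub continuousOn_const).aestronglyMeasurable
            measurableSet_ball).enorm
      _ ≤ _ := by
          rw [two_mul, ENNReal.ofReal_add (by positivity) (by positivity)]
          exact add_le_add (key y hy) (key x hx)
  rw [ENNReal.ofReal_le_ofReal_iff (by positivity)] at h1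
  have hWq : W ^ (1 / q) = W * W ^ (-(1 / p)) := by
    rw [← Real.rpow_one_add' hW0.le]
    · congr 1
      have := hpq.inv_add_inv_eq_one
      rw [one_div, one_div]; linarith
    · have := hpq.inv_add_inv_eq_one
      have h3 := hpq.symm.inv_pos
      rw [one_div]; linarith
  have hWp : W ^ (-(1 / p)) = ρ ^ (-(n / p)) * ω ^ (-(1 / p)) := by
    rw [hW, Real.mul_rpow (by positivity) hω0.le, ← Real.rpow_natCast, ← Real.rpow_mul hρ.le]
    congr 2
    field_simp
  have hρρ : ρ ^ (1 - n / p) = ρ * ρ ^ (-(n / p)) := by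
    rw [sub_eq_add_neg, Real.rpow_add hρ, Real.rpow_one]
  rw [hWq, hWp] at h1
  rw [hρρ]
  refine le_of_mul_le_mul_right (h1.trans_eq ?_) hW0
  ring

end Morrey

section Mollification

variable {E : Type*} [NormedAddCommGroup E] [NormedSpace ℝ E]

theorem fderiv_apply_add_mul_eq_zero_of_notMem_tsupport {φ : E → ℝ} {x : E}
    (hx : x ∉ tsupport φ) (y : E) (c : ℝ) : fderiv ℝ φ x y + c * φ x = 0 := by
  rw [image_eq_zero_of_notMem_tsupport hx, fderiv_of_notMem_tsupport ℝ hx]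
  simp

variable [FiniteDimensional ℝ E]

theorem exists_contDiff_approx_fderiv {φ : E → ℝ} (hφ : ContDiff ℝ 1 φ)
    (hc : HasCompactSupport φ) {ε δ : ℝ} (hε : 0 < ε) (hδ : 0 < δ) :
    ∃ ψ : E → ℝ, ContDiff ℝ (⊤ : ℕ∞) ψ ∧ tsupport ψ ⊆ cthickening δ (tsupport φ) ∧
      (∀ x, |ψ x - φ x| ≤ ε) ∧ ∀ x, ‖fderiv ℝ ψ x - fderiv ℝ φ x‖ ≤ ε := by
  borelize E
  have hu1 : UniformContinuous φ := hc.uniformContinuous_of_continuous hφ.continuous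
  have hdc : Continuous (fderiv ℝ φ) := hφ.continuous_fderiv one_ne_zero
  have hu2 : UniformContinuous (fderiv ℝ φ) := (hc.fderiv ℝ).uniformContinuous_of_continuous hdc
  obtain ⟨δ₁, hδ₁, h1⟩ := Metric.uniformContinuous_iff.1 hu1 ε hε
  obtain ⟨δ₂, hδ₂, h2⟩ := Metric.uniformContinuous_iff.1 hu2 ε hε
  set s := min δ (min δ₁ δ₂) with hs
  have hs0 : 0 < s := by positivity
  let b : ContDiffBump (0 : E) := ⟨s / 2, s, half_pos hs0, half_lt_self hs0⟩
  let μ : Measure E := Measure.addHaar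
  refine ⟨convolution (b.normed μ) φ (ContinuousLinearMap.lsmul ℝ ℝ) μ, ?_, ?_, ?_, ?_⟩
  · exact b.hasCompactSupport_normed.contDiff_convolution_left _ b.contDiff_normed
      hφ.continuous.locallyIntegrable
  · refine closure_minimal ((support_convolution_subset _).trans ?_) isClosed_cthickening
    rintro x ⟨y, hy, z, hz, rfl⟩
    rw [b.support_normed_eq, mem_ball_zero_iff] at hy
    refine mem_cthickening_of_dist_le _ z δ _ (subset_tsupport _ hz) ?_
    simpa using hy.le.trans (min_le_left _ _)
  · intro x
    rw [← Real.dist_eq]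
    refine b.dist_normed_convolution_le hφ.continuous.aestronglyMeasurable fun y hy => (h1 ?_).le
    exact (mem_ball.1 hy).trans_le ((min_le_right _ _).trans (min_le_left _ _))
  · intro x
    have hpre : (ContinuousLinearMap.lsmul ℝ ℝ : ℝ →L[ℝ] ℝ →L[ℝ] ℝ).precompR E =
        ContinuousLinearMap.lsmul ℝ ℝ := by
      ext; simp
    have hd := (hc.hasFDerivAt_convolution_right (ContinuousLinearMap.lsmul ℝ ℝ)
      ((b.continuous_normed (μ := μ)).locallyIntegrable (μ := μ)) hφ x).fderiv
    rw [hd, hpre, ← dist_eq_norm]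
    refine b.dist_normed_convolution_le hdc.aestronglyMeasurable fun y hy => (h2 ?_).le
    exact (mem_ball.1 hy).trans_le ((min_le_right _ _).trans (min_le_right _ _))

variable [MeasurableSpace E] [BorelSpace E] {μ : Measure E} [IsFiniteMeasureOnCompacts μ]

theorem integrableOn_fderiv_apply_add_mul {Ω K : Set E} (hΩ : MeasurableSet Ω)
    (hK : IsCompact K) (hKΩ : K ⊆ Ω) {A : E → E} {B : E → ℝ} {M : ℝ}
    (hA : AEStronglyMeasurable A (μ.restrict Ω)) (hB : AEStronglyMeasurable B (μ.restrict Ω))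
    (hAM : ∀ x ∈ K, ‖A x‖ ≤ M) (hBM : ∀ x ∈ K, |B x| ≤ M)
    {φ : E → ℝ} (hφ : ContDiff ℝ 1 φ) (hφK : tsupport φ ⊆ K) :
    IntegrableOn (fun x => fderiv ℝ φ x (A x) + B x * φ x) Ω μ := by
  have hc : HasCompactSupport φ := hK.of_isClosed_subset (isClosed_tsupport φ) hφK
  have hdc : Continuous (fderiv ℝ φ) := hφ.continuous_fderiv one_ne_zero
  obtain ⟨C₁, hC₁⟩ := hc.exists_bound_of_continuous hφ.continuous
  obtain ⟨C₂, hC₂⟩ := (hc.fderiv ℝ).exists_bound_of_continuous hdc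
  have hm : AEStronglyMeasurable (fun x => fderiv ℝ φ x (A x) + B x * φ x) (μ.restrict Ω) := by
    refine AEStronglyMeasurable.add ?_ (hB.mul hφ.continuous.aestronglyMeasurable)
    have hcont : Continuous fun q : (E →L[ℝ] ℝ) × E => q.1 q.2 := by fun_prop
    exact hcont.comp_aestronglyMeasurable (hdc.aestronglyMeasurable.prodMk hA)
  refine IntegrableOn.of_forall_sdiff_eq_zero (s := K) ?_ hΩ fun x hx =>
    fderiv_apply_add_mul_eq_zero_of_notMem_tsupport (fun h => hx.2 (hφK h)) _ _
  refine IntegrableOn.of_bound hK.measure_lt_top ?_ (C₂ * M + M * C₁) ?_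
  · exact hm.mono_set hKΩ
  · filter_upwards [self_mem_ae_restrict hK.measurableSet] with x hx
    refine (norm_add_le _ _).trans (add_le_add ?_ ?_)
    · exact ((fderiv ℝ φ x).le_opNorm _).trans (mul_le_mul (hC₂ x) (hAM x hx) (norm_nonneg _)
        ((norm_nonneg _).trans (hC₂ x)))
    · rw [norm_mul]
      exact mul_le_mul (hBM x hx) (hC₁ x) (norm_nonneg _) ((abs_nonneg _).trans (hBM x hx))

/-- A first order distribution with locally bounded coefficients that vanishes on smooth compactly
supported functions vanishes on `C¹` compactly supported functions. -/
theorem setIntegral_fderiv_apply_add_mul_eq_zero {Ω : Set E} (hΩ : IsOpen Ω)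
    {A : E → E} {B : E → ℝ}
    (hA : AEStronglyMeasurable A (μ.restrict Ω)) (hB : AEStronglyMeasurable B (μ.restrict Ω))
    (hbd : ∀ K ⊆ Ω, IsCompact K → ∃ M, ∀ x ∈ K, ‖A x‖ ≤ M ∧ |B x| ≤ M)
    (h : ∀ φ : E → ℝ, ContDiff ℝ (⊤ : ℕ∞) φ → HasCompactSupport φ → tsupport φ ⊆ Ω →
      ∫ x in Ω, (fderiv ℝ φ x (A x) + B x * φ x) ∂μ = 0)
    {φ : E → ℝ} (hφ : ContDiff ℝ 1 φ) (hc : HasCompactSupport φ) (hφΩ : tsupport φ ⊆ Ω) :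
    IntegrableOn (fun x => fderiv ℝ φ x (A x) + B x * φ x) Ω μ ∧
      ∫ x in Ω, (fderiv ℝ φ x (A x) + B x * φ x) ∂μ = 0 := by
  obtain ⟨δ, hδ, hδΩ⟩ := hc.isCompact.exists_cthickening_subset_open hΩ hφΩ
  set K := cthickening δ (tsupport φ) with hKdef
  have hK : IsCompact K := hc.isCompact.cthickening
  obtain ⟨M, hM⟩ := hbd K hδΩ hK
  have hφK : tsupport φ ⊆ K := self_subset_cthickening _
  have hint : ∀ ψ : E → ℝ, ContDiff ℝ 1 ψ → tsupport ψ ⊆ K →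
      IntegrableOn (fun x => fderiv ℝ ψ x (A x) + B x * ψ x) Ω μ := fun ψ h1 h2 =>
    integrableOn_fderiv_apply_add_mul hΩ.measurableSet hK hδΩ hA hB (fun x hx => (hM x hx).1)
      (fun x hx => (hM x hx).2) h1 h2
  refine ⟨hint φ hφ hφK, ?_⟩
  set M' := max M 0 with hM'
  have key : ∀ ε > 0, |∫ x in Ω, (fderiv ℝ φ x (A x) + B x * φ x) ∂μ| ≤
      ε * (2 * M' * μ.real K) := by
    intro ε hε
    obtain ⟨ψ, hψ, hψK, hψ0, hψ1⟩ := exists_contDiff_approx_fderiv hφ hc hε hδ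
    have hψ' : ContDiff ℝ 1 ψ := hψ.of_le (by exact_mod_cast le_top)
    have hψz := h ψ hψ (hK.of_isClosed_subset (isClosed_tsupport ψ) hψK) (hψK.trans hδΩ)
    rw [← sub_zero (∫ x in Ω, (fderiv ℝ φ x (A x) + B x * φ x) ∂μ), ← hψz,
      ← integral_sub (hint φ hφ hφK) (hint ψ hψ' hψK),
      setIntegral_eq_of_subset_of_forall_sdiff_eq_zero hΩ.measurableSet hδΩ]
    · rw [← Real.norm_eq_abs]
      refine (norm_setIntegral_le_of_norm_le_const (C := ε * (2 * M')) hK.measure_lt_top ?_).trans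
        (by rw [mul_assoc])
      intro x hx
      have e : fderiv ℝ φ x (A x) + B x * φ x - (fderiv ℝ ψ x (A x) + B x * ψ x) =
          -((fderiv ℝ ψ x - fderiv ℝ φ x) (A x) + B x * (ψ x - φ x)) := by
        simp only [_root_.sub_apply]; ring
      rw [e, norm_neg]
      have hA' : ‖A x‖ ≤ M' := (hM x hx).1.trans (le_max_left _ _)
      have hB' : |B x| ≤ M' := (hM x hx).2.trans (le_max_left _ _)
      have t1 : ‖(fderiv ℝ ψ x - fderiv ℝ φ x) (A x)‖ ≤ ε * M' :=
        ((fderiv ℝ ψ x - fderiv ℝ φ x).le_opNorm _).trans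
          (mul_le_mul (hψ1 x) hA' (norm_nonneg _) hε.le)
      have t2 : ‖B x * (ψ x - φ x)‖ ≤ M' * ε := by
        rw [norm_mul]
        exact mul_le_mul hB' (hψ0 x) (norm_nonneg _) (le_max_right _ _)
      refine (norm_add_le _ _).trans ?_
      linarith
    · intro x hx
      have h1 := fderiv_apply_add_mul_eq_zero_of_notMem_tsupport
        (fun h => hx.2 (hφK h)) (A x) (B x)
      have h2 := fderiv_apply_add_mul_eq_zero_of_notMem_tsupport
        (fun h => hx.2 (hψK h)) (A x) (B x)
      rw [h1, h2, sub_zero]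
  have hlim : Tendsto (fun ε : ℝ => ε * (2 * M' * μ.real K)) (𝓝[>] 0) (𝓝 0) := by
    have : Tendsto (fun ε : ℝ => ε * (2 * M' * μ.real K)) (𝓝 0) (𝓝 (0 * (2 * M' * μ.real K))) :=
      (continuous_id.mul continuous_const).tendsto 0
    rw [zero_mul] at this
    exact this.mono_left nhdsWithin_le_nhds
  exact abs_eq_zero.1 (le_antisymm (ge_of_tendsto hlim
    (by filter_upwards [self_mem_nhdsWithin] with ε hε using key ε hε)) (abs_nonneg _))

end Mollification

section Glue

variable {E : Type*} [NormedAddCommGroup E] [NormedSpace ℝ E]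

theorem hasFDerivAt_indicator_comp {Ω D : Set E} (hΩ : IsOpen Ω) (hD : IsOpen D)
    (hDΩ : closure D ⊆ Ω) {v : E → ℝ} (hv : ContDiffOn ℝ 1 v Ω) {a : ℝ}
    (hfr : ∀ x ∈ frontier D, a < v x) {G G' : ℝ → ℝ} (hG : ∀ t, HasDerivAt G (G' t) t)
    (hGa : ∀ t, a ≤ t → G t = 0) (x : E) :
    HasFDerivAt (D.indicator (G ∘ v)) (D.indicator (fun x => G' (v x) • fderiv ℝ v x) x) x := by
  by_cases hx : x ∈ D
  · rw [indicator_of_mem hx]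
    have hvx : HasFDerivAt v (fderiv ℝ v x) x := ((hv.contDiffAt
      (hΩ.mem_nhds (hDΩ (subset_closure hx)))).differentiableAt one_ne_zero).hasFDerivAt
    refine ((hG (v x)).comp_hasFDerivAt x hvx).congr_of_eventuallyEq ?_
    filter_upwards [hD.mem_nhds hx] with y hy using indicator_of_mem hy _
  · rw [indicator_of_notMem hx]
    refine (hasFDerivAt_const (0 : ℝ) x).congr_of_eventuallyEq ?_
    by_cases hxc : x ∈ closure D
    · have hxf : x ∈ frontier D := by rw [hD.frontier_eq]; exact ⟨hxc, hx⟩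
      have hcv : ContinuousAt v x := hv.continuousOn.continuousAt (hΩ.mem_nhds (hDΩ hxc))
      filter_upwards [hcv.eventually_const_lt (hfr x hxf)] with y hy
      by_cases hyD : y ∈ D
      · rw [indicator_of_mem hyD]; exact hGa _ hy.le
      · exact indicator_of_notMem hyD _
    · filter_upwards [isClosed_closure.isOpen_compl.mem_nhds hxc] with y hy
      exact indicator_of_notMem (fun h => hy (subset_closure h)) _

theorem contDiff_indicator_comp {Ω D : Set E} (hΩ : IsOpen Ω) (hD : IsOpen D)
    (hDΩ : closure D ⊆ Ω) {v : E → ℝ} (hv : ContDiffOn ℝ 1 v Ω) {a : ℝ}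
    (hfr : ∀ x ∈ frontier D, a < v x) {G : ℝ → ℝ} (hG : ContDiff ℝ 1 G)
    (hGa : ∀ t, a ≤ t → G t = 0) : ContDiff ℝ 1 (D.indicator (G ∘ v)) := by
  rw [contDiff_iff_contDiffAt]
  intro x
  by_cases hx : x ∈ D
  · have hvx := hv.contDiffAt (hΩ.mem_nhds (hDΩ (subset_closure hx)))
    refine (hG.contDiffAt.comp x hvx).congr_of_eventuallyEq ?_
    filter_upwards [hD.mem_nhds hx] with y hy using indicator_of_mem hy _
  · refine (contDiffAt_const (c := (0 : ℝ))).congr_of_eventuallyEq ?_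
    by_cases hxc : x ∈ closure D
    · have hxf : x ∈ frontier D := by rw [hD.frontier_eq]; exact ⟨hxc, hx⟩
      have hcv : ContinuousAt v x := hv.continuousOn.continuousAt (hΩ.mem_nhds (hDΩ hxc))
      filter_upwards [hcv.eventually_const_lt (hfr x hxf)] with y hy
      by_cases hyD : y ∈ D
      · rw [indicator_of_mem hyD]; exact hGa _ hy.le
      · exact indicator_of_notMem hyD _
    · filter_upwards [isClosed_closure.isOpen_compl.mem_nhds hxc] with y hy
      exact indicator_of_notMem (fun h => hy (subset_closure h)) _

theorem hasDerivAt_max_sub_zero_rpow (a : ℝ) {s : ℝ} (hs : 1 < s) (t : ℝ) :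
    HasDerivAt (fun t => max (a - t) 0 ^ s) (-(s * max (a - t) 0 ^ (s - 1))) t := by
  have hs0 : s ≠ 0 := by linarith
  have hs1 : s - 1 ≠ 0 := by linarith
  rcases lt_trichotomy t a with h | h | h
  · have h1 : HasDerivAt (fun t : ℝ => (a - t) ^ s) (-1 * s * (a - t) ^ (s - 1)) t :=
      ((hasDerivAt_id t).const_sub a).rpow_const (Or.inr hs.le)
    have e : max (a - t) 0 = a - t := max_eq_left (by linarith)
    rw [e]
    refine (h1.congr_of_eventuallyEq ?_).congr_deriv (by ring)
    filter_upwards [Iio_mem_nhds h] with y hy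
    rw [max_eq_left (by simp only [mem_Iio] at hy; linarith)]
  · subst h
    have h0 : HasDerivAt (fun y : ℝ => |y - t| ^ s) 0 t := by
      have h3 : HasDerivAt (fun z : ℝ => |z| ^ s) 0 (t - t) := by
        rw [sub_self]
        simpa using hasDerivAt_abs_rpow 0 hs
      exact HasDerivAt.comp_sub_const t t h3
    rw [sub_self, max_self, Real.zero_rpow hs1, mul_zero, neg_zero]
    rw [hasDerivAt_iff_isLittleO] at h0 ⊢
    refine (Asymptotics.IsBigO.of_norm_le fun y => ?_).trans_isLittleO h0
    have hm : max (t - y) 0 ≤ |y - t| := by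
      rw [abs_sub_comm]; exact max_le (le_abs_self _) (abs_nonneg _)
    simp only [sub_self, max_self, abs_zero, Real.zero_rpow hs0, smul_zero, sub_zero]
    rw [Real.norm_of_nonneg (by positivity)]
    gcongr
  · have e : max (a - t) 0 = 0 := max_eq_right (by linarith)
    rw [e, Real.zero_rpow hs1, mul_zero, neg_zero]
    refine (hasDerivAt_const t (0 : ℝ)).congr_of_eventuallyEq ?_
    filter_upwards [Ioi_mem_nhds h] with y hy
    rw [max_eq_right (by simp only [mem_Ioi] at hy; linarith), Real.zero_rpow hs0]

theorem contDiff_max_sub_zero_rpow (a : ℝ) {s : ℝ} (hs : 1 < s) :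
    ContDiff ℝ 1 (fun t : ℝ => max (a - t) 0 ^ s) := by
  rw [contDiff_one_iff_deriv]
  refine ⟨fun t => (hasDerivAt_max_sub_zero_rpow a hs t).differentiableAt, ?_⟩
  have : deriv (fun t : ℝ => max (a - t) 0 ^ s) = fun t => -(s * max (a - t) 0 ^ (s - 1)) :=
    funext fun t => (hasDerivAt_max_sub_zero_rpow a hs t).deriv
  rw [this]
  have h : Continuous fun t : ℝ => max (a - t) 0 ^ (s - 1) :=
    Continuous.rpow_const (by fun_prop) fun _ => Or.inr (by linarith)
  fun_prop

end Glue

section WeakForm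

variable {d : ℕ}

lemma fderiv_apply_gradient (φ v : Ed d → ℝ) (x : Ed d) :
    fderiv ℝ φ x (gradient v x) = ⟪gradient v x, gradient φ x⟫ := by
  rw [real_inner_comm, ← InnerProductSpace.toDual_apply_apply (𝕜 := ℝ), gradient, gradient,
    LinearIsometryEquiv.apply_symm_apply]

lemma norm_gradient (v : Ed d → ℝ) (x : Ed d) : ‖gradient v x‖ = ‖fderiv ℝ v x‖ := by
  rw [gradient, LinearIsometryEquiv.norm_map]

lemma fderiv_apply_gradient_self (v : Ed d → ℝ) (x : Ed d) :
    fderiv ℝ v x (gradient v x) = ‖fderiv ℝ v x‖ ^ 2 := by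
  rw [fderiv_apply_gradient, real_inner_self_eq_norm_sq, norm_gradient]

lemma measurable_gradient (v : Ed d → ℝ) : Measurable (gradient v) :=
  (InnerProductSpace.toDual ℝ (Ed d)).symm.continuous.measurable.comp (measurable_fderiv ℝ v)

/-- The weak formulation of the equation extends to compactly supported `C¹` test functions. -/
lemma IsSolution.integral_eq_zero {p : ℝ} {V : Ed d → ℝ} {Ω : Set (Ed d)} {v : Ed d → ℝ}
    (hsol : IsSolution p V Ω v) (hp : 2 < p) (hΩ : IsOpen Ω) (hVm : Measurable V) {Λ : ℝ}
    (hV : ∀ x ∈ Ω, |V x| ≤ Λ) (hv : ContDiffOn ℝ 1 v Ω) {φ : Ed d → ℝ} (hφ : ContDiff ℝ 1 φ)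
    (hc : HasCompactSupport φ) (hφΩ : tsupport φ ⊆ Ω) :
    IntegrableOn (fun x => fderiv ℝ φ x (‖fderiv ℝ v x‖ ^ (p - 2) • gradient v x)
      + V x * |v x| ^ (p - 2) * v x * φ x) Ω ∧
    ∫ x in Ω, (fderiv ℝ φ x (‖fderiv ℝ v x‖ ^ (p - 2) • gradient v x)
      + V x * |v x| ^ (p - 2) * v x * φ x) = 0 := by
  have hvc : ContinuousOn v Ω := hv.continuousOn
  have hdc : ContinuousOn (fderiv ℝ v) Ω := hv.continuousOn_fderiv_of_isOpen hΩ le_rfl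
  refine setIntegral_fderiv_apply_add_mul_eq_zero hΩ
    (B := fun x => V x * |v x| ^ (p - 2) * v x) ?_ ?_ ?_ ?_ hφ hc hφΩ
  · exact (((measurable_fderiv ℝ v).norm.pow_const _).smul
      (measurable_gradient v)).aestronglyMeasurable
  · have h1 : AEStronglyMeasurable (fun x => |v x| ^ (p - 2) * v x) (volume.restrict Ω) :=
      ((hvc.abs.rpow_const fun x _ => Or.inr (by linarith)).mul hvc).aestronglyMeasurable
        hΩ.measurableSet
    exact (hVm.aestronglyMeasurable.mul h1).congr
      (Eventually.of_forall fun x => (mul_assoc _ _ _).symm)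
  · intro K hK hKc
    obtain ⟨M₁, hM₁⟩ := hKc.exists_bound_of_continuousOn (hdc.mono hK)
    obtain ⟨M₂, hM₂⟩ := hKc.exists_bound_of_continuousOn (hvc.mono hK)
    refine ⟨max (M₁ ^ (p - 2) * M₁) (Λ * M₂ ^ (p - 2) * M₂), fun x hx => ⟨?_, ?_⟩⟩
    · refine le_max_of_le_left ?_
      rw [norm_smul, norm_gradient, Real.norm_of_nonneg (by positivity)]
      have h1 := hM₁ x hx
      have h0 := (norm_nonneg _).trans h1
      gcongr
    · refine le_max_of_le_right ?_
      have h2 := hM₂ x hx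
      rw [Real.norm_eq_abs] at h2
      have h0 := (abs_nonneg (V x)).trans (hV x (hK hx))
      rw [abs_mul, abs_mul, abs_of_nonneg (a := |v x| ^ (p - 2)) (by positivity)]
      have h1 := hV x (hK hx)
      have h3 := (abs_nonneg _).trans h2
      gcongr
  · intro φ h1 h2 h3
    rw [← hsol φ ⟨h1, h2, h3⟩]
    refine integral_congr_ae (Eventually.of_forall fun x => ?_)
    simp only [map_smul, smul_eq_mul, fderiv_apply_gradient, norm_gradient]

end WeakForm

section LogEstimate

lemma mul_rpow_sub_one_mul_le {p A b : ℝ} (hp : 1 < p) (hA : 0 ≤ A) (hb : 0 ≤ b) :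
    p * A ^ (p - 1) * b ≤
      (p - 1) / 2 * A ^ p + p * (2 * p / (p - 1)) ^ (p - 1) * b ^ p := by
  have hp0 : 0 < p := by linarith
  have hp1 : 0 < p - 1 := by linarith
  have split : ∀ t : ℝ, 0 ≤ t → t ^ p = t ^ (p - 1) * t := fun t ht => by
    rw [Real.rpow_sub_one' ht (by linarith)]
    rcases ht.eq_or_lt with rfl | ht
    · simp [hp0.ne']
    · field_simp
  rcases le_total b (A * ((p - 1) / (2 * p))) with h | h
  · have h1 : p * A ^ (p - 1) * b ≤ p * A ^ (p - 1) * (A * ((p - 1) / (2 * p))) := by gcongr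
    have h2 : p * A ^ (p - 1) * (A * ((p - 1) / (2 * p))) = (p - 1) / 2 * A ^ p := by
      rw [split A hA]; field_simp
    have h3 : 0 ≤ p * (2 * p / (p - 1)) ^ (p - 1) * b ^ p := by positivity
    linarith
  · have h1 : A ≤ 2 * p / (p - 1) * b := by
      calc A = 2 * p / (p - 1) * (A * ((p - 1) / (2 * p))) := by field_simp
        _ ≤ _ := by gcongr
    have h2 : p * A ^ (p - 1) * b ≤ p * (2 * p / (p - 1) * b) ^ (p - 1) * b := by gcongr
    rw [Real.mul_rpow (by positivity) hb] at h2
    have h3 : 0 ≤ (p - 1) / 2 * A ^ p := by positivity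
    rw [split b hb]
    linarith

lemma exists_cutoff (d : ℕ) : ∃ M : ℝ, 0 ≤ M ∧ ∀ (z : Ed d) (ρ : ℝ), 0 < ρ →
    ∃ η : Ed d → ℝ, ContDiff ℝ 1 η ∧ (∀ x, 0 ≤ η x) ∧ (∀ x, η x ≤ 1) ∧
      (∀ x ∈ ball z ρ, η x = 1) ∧ tsupport η ⊆ closedBall z (2 * ρ) ∧
      ∀ x, ‖fderiv ℝ η x‖ ≤ M / ρ := by
  let θ : ContDiffBump (0 : Ed d) := ⟨1, 2, one_pos, one_lt_two⟩
  have hθ : ContDiff ℝ 1 θ := θ.contDiff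
  obtain ⟨M, hM⟩ := (hθ.continuous_fderiv one_ne_zero).bounded_above_of_compact_support
    (θ.hasCompactSupport.fderiv ℝ)
  refine ⟨M, (norm_nonneg _).trans (hM 0), fun z ρ hρ => ?_⟩
  have haff : ContDiff ℝ 1 (fun x : Ed d => ρ⁻¹ • (x - z)) := by fun_prop
  have hnorm : ∀ x : Ed d, ‖ρ⁻¹ • (x - z)‖ = dist x z / ρ := fun x => by
    rw [norm_smul, Real.norm_of_nonneg (by positivity), dist_eq_norm]; ring
  refine ⟨fun x => θ (ρ⁻¹ • (x - z)), hθ.comp haff, fun x => θ.nonneg, fun x => θ.le_one,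
    fun x hx => ?_, ?_, fun x => ?_⟩
  · refine θ.one_of_mem_closedBall ?_
    rw [mem_closedBall, dist_zero_right, hnorm]
    exact (div_le_one hρ).2 (mem_ball.1 hx).le
  · refine closure_minimal (fun x hx => ?_) isClosed_closedBall
    have h1 : ρ⁻¹ • (x - z) ∈ Function.support θ := hx
    rw [θ.support_eq, mem_ball, dist_zero_right, hnorm] at h1
    have h2 : dist x z < 2 * ρ := (div_lt_iff₀ hρ).1 h1
    exact mem_closedBall.2 h2.le
  · have h1 : HasFDerivAt (fun x : Ed d => ρ⁻¹ • (x - z))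
        (ρ⁻¹ • ContinuousLinearMap.id ℝ (Ed d)) x :=
      ((hasFDerivAt_id x).sub_const z).const_smul ρ⁻¹
    have h2 := ((hθ.differentiable one_ne_zero _).hasFDerivAt (x := ρ⁻¹ • (x - z))).comp x h1
    have h3 : fderiv ℝ (fun x => θ (ρ⁻¹ • (x - z))) x = ρ⁻¹ • fderiv ℝ θ (ρ⁻¹ • (x - z)) := by
      refine h2.fderiv.trans ?_
      ext y; simp
    rw [h3, norm_smul, Real.norm_of_nonneg (by positivity), inv_mul_eq_div]
    gcongr
    exact hM _

/-- Caccioppoli-type inequality for `log (m - v)`. -/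
lemma exists_setIntegral_le (d : ℕ) {p : ℝ} (hp : 2 < p) : ∃ C : ℝ, 0 ≤ C ∧
    ∀ (V : Ed d → ℝ) (Ω : Set (Ed d)) (v : Ed d → ℝ) (Λ : ℝ), IsSolution p V Ω v → IsOpen Ω →
      Measurable V → (∀ x ∈ Ω, |V x| ≤ Λ) → ContDiffOn ℝ 1 v Ω →
      ∀ (z : Ed d) (ρ K m δ : ℝ), 0 < ρ → 0 < δ → 0 ≤ Λ → closedBall z (2 * ρ) ⊆ Ω →
        (∀ x ∈ closedBall z (2 * ρ), 0 < v x ∧ v x ≤ K ∧ δ ≤ m - v x) →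
        Λ * K ^ (p - 1) * δ ^ (1 - p) ≤ ρ ^ (-p) →
        IntegrableOn (fun x => (‖fderiv ℝ v x‖ / (m - v x)) ^ p) (ball z ρ) ∧
        ∫ x in ball z ρ, (‖fderiv ℝ v x‖ / (m - v x)) ^ p ≤ C * ρ ^ ((d : ℝ) - p) := by
  obtain ⟨M, hM0, hM⟩ := exists_cutoff d
  set Cp := p * (2 * p / (p - 1)) ^ (p - 1) with hCp
  have hp1 : 0 < p - 1 := by linarith
  have hCp0 : 0 ≤ Cp := by positivity
  set D := Cp * M ^ p + 1 with hD
  have hD0 : 0 ≤ D := by positivity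
  refine ⟨2 / (p - 1) * (D * (2 ^ d * volume.real (ball (0 : Ed d) 1))), by positivity, ?_⟩
  intro V Ω v Λ hsol hΩ hVm hV hv z ρ K m δ hρ hδ hΛ hBΩ hB hsmall
  obtain ⟨η, hη, hη0, hη1, hηb, hηs, hηd⟩ := hM z ρ hρ
  set B := closedBall z (2 * ρ) with hBdef
  set N : Ed d → ℝ := fun x => ‖fderiv ℝ v x‖ with hN
  have hvd : ∀ x ∈ B, HasFDerivAt v (fderiv ℝ v x) x := fun x hx =>
    ((hv.contDiffAt (hΩ.mem_nhds (hBΩ hx))).differentiableAt one_ne_zero).hasFDerivAt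
  have hu : ∀ x ∈ B, 0 < m - v x := fun x hx => hδ.trans_le (hB x hx).2.2
  set φ : Ed d → ℝ := fun x => η x ^ p * (m - v x) ^ (1 - p) with hφ
  have hφs : tsupport φ ⊆ B := by
    refine (closure_mono (t := Function.support η) fun x hx => ?_).trans hηs
    refine fun hx' => hx ?_
    simp [hφ, hx', show p ≠ 0 by linarith]
  have hφc : HasCompactSupport φ :=
    HasCompactSupport.of_support_subset_isCompact (isCompact_closedBall z (2 * ρ))
      ((subset_tsupport φ).trans hφs)
  have hφ1 : ContDiff ℝ 1 φ := by
    refine contDiff_iff_contDiffAt.2 fun x => ?_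
    by_cases hx : x ∈ B
    · refine ContDiffAt.mul ((hη.contDiffAt).rpow_const_of_le ?_) ?_
      · norm_num; linarith
      · exact (contDiffAt_const.sub (hv.contDiffAt (hΩ.mem_nhds (hBΩ hx)))).rpow_const_of_ne
          (hu x hx).ne'
    · have h0 : φ =ᶠ[𝓝 x] 0 := by
        filter_upwards [(isClosed_tsupport φ).isOpen_compl.mem_nhds fun h => hx (hφs h)] with y hy
        exact image_eq_zero_of_notMem_tsupport hy
      exact (contDiffAt_const (c := (0 : ℝ))).congr_of_eventuallyEq h0
  obtain ⟨hint, heq⟩ := hsol.integral_eq_zero hp hΩ hVm hV hv hφ1 hφc (hφs.trans hBΩ)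
  set F : Ed d → ℝ := fun x => fderiv ℝ φ x (‖fderiv ℝ v x‖ ^ (p - 2) • gradient v x)
      + V x * |v x| ^ (p - 2) * v x * φ x with hF
  have hFB : ∫ x in B, F x = 0 := by
    rw [← heq]
    refine (setIntegral_eq_of_subset_of_forall_sdiff_eq_zero hΩ.measurableSet hBΩ
      fun x hx => ?_).symm
    exact fderiv_apply_add_mul_eq_zero_of_notMem_tsupport (fun h => hx.2 (hφs h)) _ _
  set A : Ed d → ℝ := fun x => η x * (N x / (m - v x)) with hA
  have hA0 : ∀ x ∈ B, 0 ≤ A x := fun x hx =>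
    mul_nonneg (hη0 x) (div_nonneg (norm_nonneg _) (hu x hx).le)
  have hpt : ∀ x ∈ B, (p - 1) / 2 * A x ^ p - D * ρ ^ (-p) ≤ F x := by
    intro x hx
    have hux := hu x hx
    have hux' : δ ≤ m - v x := (hB x hx).2.2
    have hv0 := (hB x hx).1
    have hvK := (hB x hx).2.1
    have hNx : 0 ≤ N x := norm_nonneg _
    set u := m - v x with hudef
    have hf : HasFDerivAt φ (η x ^ p • (((1 - p) * u ^ (1 - p - 1)) • (-fderiv ℝ v x))
        + u ^ (1 - p) • ((p * η x ^ (p - 1)) • fderiv ℝ η x)) x := by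
      refine HasFDerivAt.mul
        ((hη.differentiable one_ne_zero x).hasFDerivAt.rpow_const (Or.inr (by linarith))) ?_
      exact ((hvd x hx).const_sub m).rpow_const (Or.inl hux.ne')
    have hFx : F x = (p - 1) * (η x ^ p * u ^ (-p) * (N x ^ (p - 2) * N x ^ 2))
        + p * (η x ^ (p - 1) * u ^ (1 - p) * N x ^ (p - 2)) * fderiv ℝ η x (gradient v x)
        + V x * (|v x| ^ (p - 2) * v x) * (η x ^ p * u ^ (1 - p)) := by
      have h0 : F x = fderiv ℝ φ x (‖fderiv ℝ v x‖ ^ (p - 2) • gradient v x)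
        + V x * |v x| ^ (p - 2) * v x * (η x ^ p * u ^ (1 - p)) := rfl
      rw [h0, hf.fderiv, show 1 - p - 1 = -p by ring]
      simp only [map_smul, add_apply, smul_apply, neg_apply, smul_eq_mul,
        fderiv_apply_gradient_self, hN]
      ring
    have hN2 : N x ^ (p - 2) * N x = N x ^ (p - 1) := by
      rw [← Real.rpow_add_one' hNx (by linarith)]; ring_nf
    have hN1 : N x ^ (p - 1) * N x = N x ^ p := by
      rw [← Real.rpow_add_one' hNx (by linarith)]; ring_nf
    have hAx : ∀ s : ℝ, A x ^ s = η x ^ s * N x ^ s * u ^ (-s) := fun s => by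
      rw [Real.mul_rpow (hη0 x) (div_nonneg hNx hux.le), Real.div_rpow hNx hux.le,
        Real.rpow_neg hux.le]
      ring
    have e1 : η x ^ p * u ^ (-p) * (N x ^ (p - 2) * N x ^ 2) = A x ^ p := by
      rw [hAx, ← hN1, ← hN2]; ring
    have e2 : η x ^ (p - 1) * u ^ (1 - p) * (N x ^ (p - 2) * N x) = A x ^ (p - 1) := by
      rw [hAx, ← hN2, neg_sub]; ring
    have e3 : |v x| ^ (p - 2) * v x = v x ^ (p - 1) := by
      rw [abs_of_pos hv0, ← Real.rpow_add_one' hv0.le (by linarith)]; ring_nf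
    have i1 : -(‖fderiv ℝ η x‖ * N x) ≤ fderiv ℝ η x (gradient v x) := by
      have := (fderiv ℝ η x).le_opNorm (gradient v x)
      rw [norm_gradient, Real.norm_eq_abs] at this
      exact (neg_le_neg this).trans (neg_abs_le _)
    have i2 : p * A x ^ (p - 1) * ‖fderiv ℝ η x‖ ≤
        (p - 1) / 2 * A x ^ p + Cp * (M / ρ) ^ p := by
      refine (mul_rpow_sub_one_mul_le (by linarith) (hA0 x hx) (norm_nonneg _)).trans ?_
      gcongr
      exact hηd x
    have i3 : -ρ ^ (-p) ≤ V x * v x ^ (p - 1) * (η x ^ p * u ^ (1 - p)) := by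
      have j1 : |V x * v x ^ (p - 1) * (η x ^ p * u ^ (1 - p))| ≤
          Λ * K ^ (p - 1) * (1 * δ ^ (1 - p)) := by
        rw [abs_mul, abs_mul, abs_of_nonneg (a := v x ^ (p - 1)) (by positivity),
          abs_of_nonneg (mul_nonneg (Real.rpow_nonneg (hη0 x) _) (by positivity))]
        have k1 := hV x (hBΩ hx)
        have k2 : η x ^ p ≤ 1 := Real.rpow_le_one (hη0 x) (hη1 x) (by linarith)
        have k3 : u ^ (1 - p) ≤ δ ^ (1 - p) :=
          Real.rpow_le_rpow_of_nonpos hδ hux' (by linarith)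
        have k4 := hv0.le.trans hvK
        have k5 := mul_nonneg (Real.rpow_nonneg (hη0 x) p) (Real.rpow_nonneg hux.le (1 - p))
        gcongr
      have := neg_abs_le (V x * v x ^ (p - 1) * (η x ^ p * u ^ (1 - p)))
      linarith
    have i4 : -(p * A x ^ (p - 1) * ‖fderiv ℝ η x‖) ≤
        p * (η x ^ (p - 1) * u ^ (1 - p) * N x ^ (p - 2)) * fderiv ℝ η x (gradient v x) := by
      have : p * (η x ^ (p - 1) * u ^ (1 - p) * N x ^ (p - 2)) * -(‖fderiv ℝ η x‖ * N x) ≤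
          p * (η x ^ (p - 1) * u ^ (1 - p) * N x ^ (p - 2)) * fderiv ℝ η x (gradient v x) := by
        have := hη0 x
        gcongr
      refine le_trans (le_of_eq ?_) this
      rw [← e2]; ring
    have e4 : (M / ρ) ^ p = M ^ p * ρ ^ (-p) := by
      rw [Real.div_rpow hM0 hρ.le, Real.rpow_neg hρ.le, div_eq_mul_inv]
    rw [hFx, e1, e3, hD]
    rw [e4] at i2
    linarith
  have hAc : ContinuousOn (fun x => A x ^ p) B := by
    refine ContinuousOn.rpow_const ?_ fun x _ => Or.inr (by linarith)
    refine hη.continuous.continuousOn.mul (ContinuousOn.div ?_ ?_ fun x hx => (hu x hx).ne')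
    · exact ((hv.continuousOn_fderiv_of_isOpen hΩ le_rfl).mono hBΩ).norm
    · exact continuousOn_const.sub (hv.continuousOn.mono hBΩ)
  have hAi : IntegrableOn (fun x => A x ^ p) B :=
    hAc.integrableOn_compact (isCompact_closedBall _ _)
  have hvol : volume.real B = ρ ^ d * (2 ^ d * volume.real (ball (0 : Ed d) 1)) := by
    rw [hBdef, Measure.addHaar_real_closedBall _ _ (by positivity), finrank_euclideanSpace_fin]
    ring
  have hle : (p - 1) / 2 * ∫ x in B, A x ^ p ≤ D * ρ ^ (-p) * volume.real B := by
    have h1 : ∫ x in B, ((p - 1) / 2 * A x ^ p - D * ρ ^ (-p)) ≤ ∫ x in B, F x :=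
      setIntegral_mono_on ((hAi.const_mul _).sub (integrableOn_const (by
        exact (isCompact_closedBall z (2 * ρ)).measure_lt_top.ne))) (hint.mono_set hBΩ)
        measurableSet_closedBall hpt
    rw [hFB, integral_sub (hAi.const_mul _) (integrableOn_const (by
        exact (isCompact_closedBall z (2 * ρ)).measure_lt_top.ne)), integral_const_mul,
        setIntegral_const, smul_eq_mul] at h1
    linarith
  have hbB : ball z ρ ⊆ B :=
    ball_subset_closedBall.trans (closedBall_subset_closedBall (by linarith))
  have hAeq : EqOn (fun x => A x ^ p) (fun x => (‖fderiv ℝ v x‖ / (m - v x)) ^ p) (ball z ρ) :=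
    fun x hx => by simp only [hA, hηb x hx, one_mul, hN]
  refine ⟨(hAi.mono_set hbB).congr_fun hAeq measurableSet_ball, ?_⟩
  rw [← setIntegral_congr_fun measurableSet_ball hAeq]
  have h2 : ∫ x in ball z ρ, A x ^ p ≤ ∫ x in B, A x ^ p :=
    setIntegral_mono_set hAi ((ae_restrict_iff' measurableSet_closedBall).2
      (Eventually.of_forall fun x hx => Real.rpow_nonneg (hA0 x hx) _)) hbB.eventuallyLE
  refine h2.trans ?_
  have h3 : ρ ^ ((d : ℝ) - p) = ρ ^ d * ρ ^ (-p) := by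
    rw [sub_eq_add_neg, Real.rpow_add hρ, Real.rpow_natCast]
  calc ∫ x in B, A x ^ p = 2 / (p - 1) * ((p - 1) / 2 * ∫ x in B, A x ^ p) := by field_simp
    _ ≤ 2 / (p - 1) * (D * ρ ^ (-p) * volume.real B) := by gcongr
    _ = _ := by rw [hvol, h3]; ring

/-- Harnack inequality for `m - v` on small balls. -/
lemma exists_harnack_ball (d : ℕ) {p : ℝ} (hp : 2 < p) (hpd : (d : ℝ) < p) :
    ∃ H : ℝ, 1 ≤ H ∧
    ∀ (V : Ed d → ℝ) (Ω : Set (Ed d)) (v : Ed d → ℝ) (Λ : ℝ), IsSolution p V Ω v → IsOpen Ω →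
      Measurable V → (∀ x ∈ Ω, |V x| ≤ Λ) → ContDiffOn ℝ 1 v Ω →
      ∀ (z : Ed d) (ρ K m δ : ℝ), 0 < ρ → 0 < δ → 0 ≤ Λ → closedBall z (2 * ρ) ⊆ Ω →
        (∀ x ∈ closedBall z (2 * ρ), 0 < v x ∧ v x ≤ K ∧ δ ≤ m - v x) →
        Λ * K ^ (p - 1) * δ ^ (1 - p) ≤ ρ ^ (-p) →
        ∀ x ∈ ball z ρ, ∀ y ∈ ball z ρ, m - v y ≤ H * (m - v x) := by
  obtain ⟨C₁, hC₁, hint⟩ := exists_setIntegral_le d hp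
  obtain ⟨C₂, hC₂, hmor⟩ := exists_morrey_ball (E := Ed d) volume (p := p) (by linarith)
    (by rwa [finrank_euclideanSpace_fin])
  rw [finrank_euclideanSpace_fin] at hmor
  refine ⟨Real.exp (C₂ * C₁ ^ (1 / p)), Real.one_le_exp (by positivity), ?_⟩
  intro V Ω v Λ hsol hΩ hVm hV hv z ρ K m δ hρ hδ hΛ hBΩ hB hsmall x hx y hy
  obtain ⟨hi, hle⟩ := hint V Ω v Λ hsol hΩ hVm hV hv z ρ K m δ hρ hδ hΛ hBΩ hB hsmall
  have hbB : ball z ρ ⊆ closedBall z (2 * ρ) :=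
    ball_subset_closedBall.trans (closedBall_subset_closedBall (by linarith))
  have hu : ∀ x ∈ ball z ρ, 0 < m - v x := fun x hx => hδ.trans_le (hB x (hbB hx)).2.2
  have hg : ContDiffOn ℝ 1 (fun x => Real.log (m - v x)) (ball z ρ) :=
    (contDiffOn_const.sub (hv.mono (hbB.trans hBΩ))).log fun x hx => (hu x hx).ne'
  have hfd : ∀ x ∈ ball z ρ, ‖fderiv ℝ (fun x => Real.log (m - v x)) x‖ =
      ‖fderiv ℝ v x‖ / (m - v x) := fun x hx => by
    have h1 := ((hv.contDiffAt (hΩ.mem_nhds (hBΩ (hbB hx)))).differentiableAt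
      one_ne_zero).hasFDerivAt
    rw [((h1.const_sub m).log (hu x hx).ne').fderiv, norm_smul, norm_neg,
      Real.norm_of_nonneg (inv_nonneg.2 (hu x hx).le)]
    ring
  have hl : ∫⁻ x in ball z ρ, ‖fderiv ℝ (fun x => Real.log (m - v x)) x‖ₑ ^ p ≤
      ENNReal.ofReal (C₁ * ρ ^ ((d : ℝ) - p)) := by
    refine le_trans (le_of_eq ?_) (ENNReal.ofReal_le_ofReal hle)
    rw [ofReal_integral_eq_lintegral_ofReal hi ((ae_restrict_iff' measurableSet_ball).2
      (Eventually.of_forall fun x hx =>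
        Real.rpow_nonneg (div_nonneg (norm_nonneg _) (hu x hx).le) _))]
    refine setLIntegral_congr_fun measurableSet_ball fun x hx => ?_
    rw [← ENNReal.ofReal_rpow_of_nonneg (div_nonneg (norm_nonneg _) (hu x hx).le) (by linarith),
      ← hfd x hx, ofReal_norm]
  have h := hmor _ z ρ _ hρ (by positivity) hg hl y hy x hx
  have he : ρ ^ (1 - (d : ℝ) / p) * (C₁ * ρ ^ ((d : ℝ) - p)) ^ (1 / p) = C₁ ^ (1 / p) := by
    rw [Real.mul_rpow hC₁ (by positivity), ← Real.rpow_mul hρ.le, mul_left_comm,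
      ← Real.rpow_add hρ, show 1 - (d : ℝ) / p + (d - p) * (1 / p) = 0 by
        field_simp; ring, Real.rpow_zero, mul_one]
  rw [mul_assoc, he] at h
  have h' := (le_abs_self _).trans h
  rw [← Real.exp_log (hu x hx), ← Real.exp_add, ← Real.log_le_iff_le_exp (hu y hy)]
  linarith

end LogEstimate

section HarnackSphere

open Module

variable {E : Type*} [NormedAddCommGroup E] [InnerProductSpace ℝ E]

lemma sq_le_two_mul_norm_sq_lineMap {x y : E} {R t : ℝ} (hx : ‖x‖ = R) (hy : ‖y‖ = R)
    (hxy : 0 ≤ ⟪x, y⟫) (ht : t ∈ Icc (0 : ℝ) 1) : R ^ 2 ≤ 2 * ‖x + t • (y - x)‖ ^ 2 := by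
  have h1 : x + t • (y - x) = (1 - t) • x + t • y := by module
  rw [h1, norm_add_sq_real, norm_smul, norm_smul, inner_smul_left, inner_smul_right, hx, hy,
    mul_pow, mul_pow, Real.norm_eq_abs, Real.norm_eq_abs, sq_abs, sq_abs]
  have h2 : 0 ≤ (1 - t) * t * ⟪x, y⟫ := by
    have := ht.1
    have := sub_nonneg.2 ht.2
    positivity
  simp only [conj_trivial]
  nlinarith [mul_nonneg (sq_nonneg (1 - 2 * t)) (sq_nonneg R)]

lemma le_pow_mul_of_inner_nonneg {u : E → ℝ} {H R : ℝ} (hH : 0 ≤ H) (hR : 0 < R)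
    (hu : ∀ z : E, R ^ 2 ≤ 2 * ‖z‖ ^ 2 → ‖z‖ ≤ R →
      ∀ x ∈ ball z (R / 4), ∀ y ∈ ball z (R / 4), u y ≤ H * u x)
    {x y : E} (hx : ‖x‖ = R) (hy : ‖y‖ = R) (hxy : 0 ≤ ⟪x, y⟫) : u y ≤ H ^ 8 * u x := by
  have hdist : ‖y - x‖ ≤ 3 / 2 * R := by
    refine abs_le_of_sq_le_sq' ?_ (by positivity) |>.2
    rw [norm_sub_sq_real, hx, hy, real_inner_comm]
    nlinarith
  set l : ℕ → E := fun k => x + ((k : ℝ) / 8) • (y - x) with hl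
  have key : ∀ k : ℕ, k ≤ 8 → u (l k) ≤ H ^ k * u x := by
    intro k
    induction k with
    | zero => simp [hl]
    | succ k ih =>
      intro hk
      have hk' : (k : ℝ) + 1 ≤ 8 := by exact_mod_cast hk
      have ht : (k : ℝ) / 8 ∈ Icc (0 : ℝ) 1 := ⟨by positivity, by linarith⟩
      have hle : ‖l k‖ ≤ R := by
        have := (convex_closedBall (0 : E) R).add_smul_sub_mem
          (mem_closedBall_zero_iff.2 hx.le) (mem_closedBall_zero_iff.2 hy.le) ht
        exact mem_closedBall_zero_iff.1 this
      have hstep : l (k + 1) ∈ ball (l k) (R / 4) := by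
        have h1 : l (k + 1) - l k = (1 / 8 : ℝ) • (y - x) := by
          simp only [hl]; push_cast; module
        rw [mem_ball, dist_eq_norm, h1, norm_smul]
        norm_num
        linarith
      calc u (l (k + 1)) ≤ H * u (l k) :=
            hu (l k) (sq_le_two_mul_norm_sq_lineMap hx hy hxy ht) hle _
              (mem_ball_self (by positivity)) _ hstep
        _ ≤ H * (H ^ k * u x) := by gcongr; exact ih (by omega)
        _ = H ^ (k + 1) * u x := by ring
  have h8 := key 8 le_rfl
  have : l 8 = y := by simp [hl]
  rwa [this] at h8

lemma exists_norm_eq_inner_eq_zero_inner_nonneg [FiniteDimensional ℝ E] (hE : 2 ≤ finrank ℝ E)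
    (x y : E) {R : ℝ} (hR : 0 < R) : ∃ z : E, ‖z‖ = R ∧ ⟪x, z⟫ = 0 ∧ 0 ≤ ⟪z, y⟫ := by
  have hne : (ℝ ∙ x)ᗮ ≠ ⊥ := fun h => by
    have h1 := (ℝ ∙ x).finrank_add_finrank_orthogonal
    rw [h, finrank_bot] at h1
    have := finrank_span_le_card (R := ℝ) ({x} : Set E)
    rw [toFinset_singleton, Finset.card_singleton] at this
    omega
  obtain ⟨w, hw, hw0⟩ := Submodule.exists_mem_ne_zero_of_ne_bot hne
  have hxw : ⟪x, w⟫ = 0 := Submodule.mem_orthogonal_singleton_iff_inner_right.1 hw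
  have hn : ‖w‖ ≠ 0 := norm_ne_zero_iff.2 hw0
  rcases le_total 0 ⟪w, y⟫ with h | h
  · refine ⟨(R / ‖w‖) • w, ?_, ?_, ?_⟩
    · rw [norm_smul, Real.norm_of_nonneg (by positivity)]; field_simp
    · rw [inner_smul_right, hxw, mul_zero]
    · rw [real_inner_smul_left]; positivity
  · refine ⟨-((R / ‖w‖) • w), ?_, ?_, ?_⟩
    · rw [norm_neg, norm_smul, Real.norm_of_nonneg (by positivity)]; field_simp
    · rw [inner_neg_right, inner_smul_right, hxw, mul_zero, neg_zero]
    · rw [inner_neg_left, real_inner_smul_left, neg_nonneg]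
      exact mul_nonpos_of_nonneg_of_nonpos (by positivity) h

lemma le_pow_mul_of_norm_eq [FiniteDimensional ℝ E] (hE : 2 ≤ finrank ℝ E) {u : E → ℝ} {H R : ℝ}
    (hH : 0 ≤ H) (hR : 0 < R)
    (hu : ∀ z : E, R ^ 2 ≤ 2 * ‖z‖ ^ 2 → ‖z‖ ≤ R →
      ∀ x ∈ ball z (R / 4), ∀ y ∈ ball z (R / 4), u y ≤ H * u x)
    {x y : E} (hx : ‖x‖ = R) (hy : ‖y‖ = R) : u y ≤ H ^ 16 * u x := by
  obtain ⟨z, hz, hxz, hzy⟩ := exists_norm_eq_inner_eq_zero_inner_nonneg hE x y hR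
  calc u y ≤ H ^ 8 * u z := le_pow_mul_of_inner_nonneg hH hR hu hz hy hzy
    _ ≤ H ^ 8 * (H ^ 8 * u x) := by
      gcongr
      exact le_pow_mul_of_inner_nonneg hH hR hu hx hz hxz.ge
    _ = H ^ 16 * u x := by ring

/-- Harnack inequality for `m - v` on spheres around an isolated singularity. -/
lemma exists_harnack_sphere (d : ℕ) (hd : 2 ≤ d) {p : ℝ} (hp : 2 < p) (hpd : (d : ℝ) < p) :
    ∃ H : ℝ, 0 ≤ H ∧
    ∀ (V : Ed d → ℝ) (Ω : Set (Ed d)) (v : Ed d → ℝ) (Λ : ℝ), IsSolution p V Ω v → IsOpen Ω →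
      Measurable V → (∀ x ∈ Ω, |V x| ≤ Λ) → ContDiffOn ℝ 1 v Ω →
      ∀ (x₀ : Ed d) (R K m δ : ℝ), 0 < R → 0 < δ → 0 ≤ Λ →
        (∀ x, x ≠ x₀ → dist x x₀ < 2 * R → x ∈ Ω ∧ 0 < v x ∧ v x ≤ K ∧ δ ≤ m - v x) →
        Λ * K ^ (p - 1) * δ ^ (1 - p) ≤ (R / 4) ^ (-p) →
        ∀ x y, dist x x₀ = R → dist y x₀ = R → m - v y ≤ H * (m - v x) := by
  obtain ⟨H, hH, hball⟩ := exists_harnack_ball d hp hpd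
  refine ⟨H ^ 16, by positivity, ?_⟩
  intro V Ω v Λ hsol hΩ hVm hV hv x₀ R K m δ hR hδ hΛ hB hsmall x y hx hy
  have key := le_pow_mul_of_norm_eq (E := Ed d) (by rwa [finrank_euclideanSpace_fin])
    (u := fun z => m - v (x₀ + z)) (H := H) (by linarith) hR ?_
    (x := x - x₀) (y := y - x₀) (by rwa [← dist_eq_norm]) (by rwa [← dist_eq_norm])
  · simpa using key
  intro z hz hzR a ha b hb
  have hmem : ∀ w ∈ closedBall (x₀ + z) (2 * (R / 4)), w ≠ x₀ ∧ dist w x₀ < 2 * R := by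
    intro w hw
    rw [mem_closedBall, dist_eq_norm] at hw
    constructor
    · rintro rfl
      rw [show w - (w + z) = -z by abel, norm_neg] at hw
      nlinarith [norm_nonneg z]
    · rw [dist_eq_norm, show w - x₀ = (w - (x₀ + z)) + z by abel]
      have := norm_add_le (w - (x₀ + z)) z
      linarith
  have hmem' : ∀ c ∈ ball z (R / 4), x₀ + c ∈ ball (x₀ + z) (R / 4) := fun c hc => by
    rwa [mem_ball, dist_add_left]
  exact hball V Ω v Λ hsol hΩ hVm hV hv (x₀ + z) (R / 4) K m δ (by positivity) hδ hΛ
    (fun w hw => (hB w (hmem w hw).1 (hmem w hw).2).1)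
    (fun w hw => (hB w (hmem w hw).1 (hmem w hw).2).2) hsmall _ (hmem' a ha) _ (hmem' b hb)

end HarnackSphere

section MinimumPrinciple

/-- Quantitative minimum principle on annuli. -/
lemma exists_sq_max_sub_le (d : ℕ) {p : ℝ} (hp : 2 < p) (hpd : (d : ℝ) < p) :
    ∃ C : ℝ, 0 ≤ C ∧
    ∀ (V : Ed d → ℝ) (Ω : Set (Ed d)) (v : Ed d → ℝ) (Λ : ℝ), IsSolution p V Ω v → IsOpen Ω →
      Measurable V → (∀ x ∈ Ω, |V x| ≤ Λ) → ContDiffOn ℝ 1 v Ω →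
      ∀ (x₀ : Ed d) (R' R K a : ℝ), 0 < R' → 0 < R → 0 ≤ Λ → 0 ≤ K → a ≤ K →
        (∀ x, dist x x₀ ∈ Icc R' R → x ∈ Ω ∧ 0 < v x ∧ v x ≤ K) →
        (∀ x, dist x x₀ = R' ∨ dist x x₀ = R → a < v x) →
        ∀ x, dist x x₀ ∈ Ioo R' R →
          max (a - v x) 0 ^ (2 : ℝ) ≤ C * (Λ * K ^ (p - 1) * K ^ (p + 1)) ^ (1 / p) * R := by
  obtain ⟨C₂, hC₂, hmor⟩ := exists_morrey_ball (E := Ed d) volume (p := p) (by linarith)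
    (by rwa [finrank_euclideanSpace_fin])
  rw [finrank_euclideanSpace_fin] at hmor
  set ω := volume.real (ball (0 : Ed d) 1) with hω
  refine ⟨C₂ * 2 ^ (1 - (d : ℝ) / p) * (2 ^ p * (ω / (p + 1))) ^ (1 / p), by positivity, ?_⟩
  intro V Ω v Λ hsol hΩ hVm hV hv x₀ R' R K a hR' hR hΛ hK haK hA hbd x hx
  set D : Set (Ed d) := (fun x => dist x x₀) ⁻¹' Ioo R' R with hD
  have hdist : Continuous fun x : Ed d => dist x x₀ := by fun_prop
  have hDo : IsOpen D := isOpen_Ioo.preimage hdist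
  have hDm := hDo.measurableSet
  have hcl : closure D ⊆ (fun x => dist x x₀) ⁻¹' Icc R' R :=
    closure_minimal (preimage_mono Ioo_subset_Icc_self) (isClosed_Icc.preimage hdist)
  have hclΩ : closure D ⊆ Ω := fun y hy => (hA y (hcl hy)).1
  have hDΩ : D ⊆ Ω := subset_closure.trans hclΩ
  have hDB : D ⊆ ball x₀ R := fun y hy => mem_ball.2 hy.2
  have hcc : IsCompact (closure D) :=
    (isBounded_ball.subset hDB).isCompact_closure
  have hfr : ∀ y ∈ frontier D, a < v y := fun y hy => by
    have h1 := hcl hy.1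
    have h2 : y ∉ D := by rw [← hDo.interior_eq]; exact hy.2
    refine hbd y ?_
    by_contra! h
    exact h2 ⟨lt_of_le_of_ne h1.1 (Ne.symm h.1), lt_of_le_of_ne h1.2 h.2⟩
  have hvol : volume.real D ≤ R ^ d * ω := by
    refine (measureReal_mono (hDB.trans ball_subset_closedBall)
      measure_closedBall_lt_top.ne).trans (le_of_eq ?_)
    rw [Measure.addHaar_real_closedBall _ _ hR.le, finrank_euclideanSpace_fin]
  set N : Ed d → ℝ := fun x => ‖fderiv ℝ v x‖ with hN
  set P : Ed d → ℝ := fun x => max (a - v x) 0 with hP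
  have hP0 : ∀ y, 0 ≤ P y := fun y => le_max_right _ _
  have hPK : ∀ y ∈ D, P y ≤ K := fun y hy =>
    max_le (by linarith [(hA y (hcl (subset_closure hy))).2.1]) hK
  have hGa : ∀ s : ℝ, s ≠ 0 → ∀ t, a ≤ t → max (a - t) 0 ^ s = 0 := fun s hs t ht => by
    rw [max_eq_right (by linarith), Real.zero_rpow hs]
  -- the energy estimate
  set φ := D.indicator ((fun t => max (a - t) 0 ^ (p + 1)) ∘ v) with hφ
  have hφs : tsupport φ ⊆ closure D := closure_mono support_indicator_subset
  have hφc : HasCompactSupport φ :=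
    HasCompactSupport.of_support_subset_isCompact hcc ((subset_tsupport φ).trans hφs)
  have hφ1 : ContDiff ℝ 1 φ :=
    contDiff_indicator_comp hΩ hDo hclΩ hv hfr
      (contDiff_max_sub_zero_rpow a (by linarith)) (hGa _ (by linarith))
  have hφd := hasFDerivAt_indicator_comp hΩ hDo hclΩ hv hfr
      (hasDerivAt_max_sub_zero_rpow a (s := p + 1) (by linarith)) (hGa _ (by linarith))
  obtain ⟨hint, heq⟩ := hsol.integral_eq_zero hp hΩ hVm hV hv hφ1 hφc (hφs.trans hclΩ)
  set F : Ed d → ℝ := fun x => fderiv ℝ φ x (‖fderiv ℝ v x‖ ^ (p - 2) • gradient v x)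
      + V x * |v x| ^ (p - 2) * v x * φ x with hF
  have hFD : ∫ x in D, F x = 0 := by
    rw [← heq]
    refine (setIntegral_eq_of_subset_of_forall_sdiff_eq_zero hΩ.measurableSet hDΩ
      fun y hy => ?_).symm
    simp only [hF, (hφd y).fderiv, hφ, indicator_of_notMem hy.2]
    simp
  have hPN : ContinuousOn (fun x => P x ^ p * N x ^ p) (closure D) := by
    refine ContinuousOn.mul (ContinuousOn.rpow_const ?_ fun x _ => Or.inr (by linarith))
      (ContinuousOn.rpow_const ?_ fun x _ => Or.inr (by linarith))
    · exact (continuousOn_const.sub (hv.continuousOn.mono hclΩ)).sup continuousOn_const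
    · exact ((hv.continuousOn_fderiv_of_isOpen hΩ le_rfl).mono hclΩ).norm
  have hPNi : IntegrableOn (fun x => P x ^ p * N x ^ p) D :=
    (hPN.integrableOn_compact hcc).mono_set subset_closure
  have hpt : ∀ y ∈ D, F y ≤ -((p + 1) * (P y ^ p * N y ^ p)) + Λ * K ^ (p - 1) * K ^ (p + 1) := by
    intro y hy
    obtain ⟨hyΩ, hv0, hvK⟩ := hA y (hcl (subset_closure hy))
    have hNy : 0 ≤ N y := norm_nonneg _
    have hFy : F y = -((p + 1) * (P y ^ p * (N y ^ (p - 2) * N y ^ 2)))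
        + V y * (|v y| ^ (p - 2) * v y) * P y ^ (p + 1) := by
      simp only [hF, (hφd y).fderiv, hφ, indicator_of_mem hy, map_smul, smul_apply, smul_eq_mul,
        fderiv_apply_gradient_self, hN, hP, Function.comp_apply, add_sub_cancel_right]
      ring
    have e1 : N y ^ (p - 2) * N y ^ 2 = N y ^ p := by
      rw [← Real.rpow_natCast, ← Real.rpow_add_of_nonneg hNy (by linarith) (by norm_num)]
      norm_num
    have e3 : |v y| ^ (p - 2) * v y = v y ^ (p - 1) := by
      rw [abs_of_pos hv0, ← Real.rpow_add_one' hv0.le (by linarith)]; ring_nf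
    rw [hFy, e1, e3]
    refine add_le_add le_rfl ((le_abs_self _).trans ?_)
    rw [abs_mul, abs_mul, abs_of_nonneg (a := v y ^ (p - 1)) (by positivity),
      abs_of_nonneg (a := P y ^ (p + 1)) (Real.rpow_nonneg (hP0 y) _)]
    have k1 := hV y hyΩ
    have k2 := hPK y hy
    have k3 := hP0 y
    have k4 : 0 ≤ p - 1 := by linarith
    gcongr
  have hDfin : volume D ≠ ⊤ := ((measure_mono hDB).trans_lt measure_ball_lt_top).ne
  have henergy : ∫ x in D, P x ^ p * N x ^ p ≤
      Λ * K ^ (p - 1) * K ^ (p + 1) * (R ^ d * (ω / (p + 1))) := by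
    have h1 := setIntegral_mono_on (hint.mono_set hDΩ)
      ((hPNi.const_mul (p + 1)).neg.add (integrableOn_const hDfin)) hDm hpt
    rw [hFD, integral_add' (hPNi.const_mul (p + 1)).neg (integrableOn_const hDfin),
      integral_neg', integral_const_mul, setIntegral_const, smul_eq_mul] at h1
    have h2 : volume.real D * (Λ * K ^ (p - 1) * K ^ (p + 1)) ≤
        R ^ d * ω * (Λ * K ^ (p - 1) * K ^ (p + 1)) := by gcongr
    have h3 : (p + 1) * ∫ x in D, P x ^ p * N x ^ p ≤
        R ^ d * ω * (Λ * K ^ (p - 1) * K ^ (p + 1)) := by linarith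
    calc _ = ((p + 1) * ∫ x in D, P x ^ p * N x ^ p) / (p + 1) := by field_simp
      _ ≤ R ^ d * ω * (Λ * K ^ (p - 1) * K ^ (p + 1)) / (p + 1) := by gcongr
      _ = _ := by ring
  -- Morrey's inequality for the square of the truncation
  set w := D.indicator ((fun t => max (a - t) 0 ^ (2 : ℝ)) ∘ v) with hw
  have hw1 : ContDiff ℝ 1 w :=
    contDiff_indicator_comp hΩ hDo hclΩ hv hfr
      (contDiff_max_sub_zero_rpow a (by norm_num)) (hGa _ (by norm_num))
  have hwd := hasFDerivAt_indicator_comp hΩ hDo hclΩ hv hfr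
      (hasDerivAt_max_sub_zero_rpow a (s := 2) (by norm_num)) (hGa _ (by norm_num))
  have hl : ∫⁻ y in ball x₀ (2 * R), ‖fderiv ℝ w y‖ₑ ^ p ≤
      ENNReal.ofReal (2 ^ p * (Λ * K ^ (p - 1) * K ^ (p + 1) * (R ^ d * (ω / (p + 1))))) := by
    have hwn : ∀ y, ‖fderiv ℝ w y‖ₑ ^ p =
        D.indicator (fun y => ENNReal.ofReal (2 ^ p * (P y ^ p * N y ^ p))) y := fun y => by
      rw [(hwd y).fderiv]
      by_cases hy : y ∈ D
      · rw [indicator_of_mem hy, indicator_of_mem hy, ← ofReal_norm,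
          ENNReal.ofReal_rpow_of_nonneg (norm_nonneg _) (by linarith), norm_smul, norm_neg,
          Real.norm_of_nonneg (by positivity), Real.mul_rpow (by positivity) (norm_nonneg _),
          Real.mul_rpow (by positivity) (by positivity)]
        norm_num [hP, hN, mul_assoc]
      · rw [indicator_of_notMem hy, indicator_of_notMem hy]
        exact (congrArg (· ^ p) (enorm_zero (E := Ed d →L[ℝ] ℝ))).trans
          (ENNReal.zero_rpow_of_pos (by linarith))
    simp_rw [hwn]
    refine (setLIntegral_le_lintegral _ _).trans ?_
    rw [lintegral_indicator hDm, ← ofReal_integral_eq_lintegral_ofReal (hPNi.const_mul _)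
      (Eventually.of_forall fun y => by have := hP0 y; positivity), integral_const_mul]
    gcongr
  have h := hmor w x₀ (2 * R) _ (by positivity) (by positivity) hw1.contDiffOn hl x
    (mem_ball.2 (by linarith [hx.2])) x₀ (mem_ball_self (by positivity))
  have hwx₀ : w x₀ = 0 := indicator_of_notMem (fun h => by
    have := h.1; simp only [dist_self] at this; linarith) _
  have hwx : w x = max (a - v x) 0 ^ (2 : ℝ) := indicator_of_mem (show x ∈ D from hx) _
  rw [hwx₀, hwx, sub_zero, abs_of_nonneg (by positivity)] at h
  refine h.trans (le_of_eq ?_)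
  have e1 : R ^ (1 - (d : ℝ) / p) * (R ^ d) ^ (1 / p) = R := by
    rw [← Real.rpow_natCast, ← Real.rpow_mul hR.le, ← Real.rpow_add hR, mul_one_div,
      sub_add_cancel, Real.rpow_one]
  rw [show 2 ^ p * (Λ * K ^ (p - 1) * K ^ (p + 1) * (R ^ d * (ω / (p + 1)))) =
      2 ^ p * (ω / (p + 1)) * (Λ * K ^ (p - 1) * K ^ (p + 1)) * R ^ d by ring,
    Real.mul_rpow two_pos.le hR.le, Real.mul_rpow (by positivity) (by positivity),
    Real.mul_rpow (by positivity) (by positivity)]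
  linear_combination C₂ * 2 ^ (1 - (d : ℝ) / p) * (2 ^ p * (ω / (p + 1))) ^ (1 / p) *
    (Λ * K ^ (p - 1) * K ^ (p + 1)) ^ (1 / p) * e1

end MinimumPrinciple

theorem statement_15 (d : ℕ) (hd : 2 ≤ d) (p : ℝ) (hp : 1 < p) (hpd : (d : ℝ) < p)
    (x₀ : Ed d) (r : ℝ) (hr : 0 < r)
    (V : Ed d → ℝ) (hVm : Measurable V)
    (hVb : ∃ C : ℝ, ∀ x ∈ Metric.ball x₀ r \ {x₀}, |V x| ≤ C)
    (v : Ed d → ℝ) (hv : ContDiffOn ℝ 1 v (Metric.ball x₀ r \ {x₀}))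
    (hvpos : ∀ x ∈ Metric.ball x₀ r \ {x₀}, 0 < v x)
    (hsol : IsSolution p V (Metric.ball x₀ r \ {x₀}) v)
    (hbdd : ∃ c C : ℝ, 0 < c ∧ ∃ ρ : ℝ, 0 < ρ ∧ ρ ≤ r ∧
      ∀ x ∈ Metric.ball x₀ ρ \ {x₀}, c ≤ v x ∧ v x ≤ C) :
    ∃ L : ℝ, Tendsto v (𝓝[≠] x₀) (𝓝 L) := by
  have hp2 : 2 < p := lt_of_le_of_lt (by exact_mod_cast hd) hpd
  obtain ⟨Λ₀, hΛ₀⟩ := hVb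
  obtain ⟨c, K, hc, ρ₀, hρ₀, hρ₀r, hcK⟩ := hbdd
  set Ω : Set (Ed d) := ball x₀ r \ {x₀} with hΩdef
  have hΩ : IsOpen Ω := isOpen_ball.sdiff isClosed_singleton
  obtain ⟨Λ, hΛ, hV⟩ : ∃ Λ : ℝ, 0 ≤ Λ ∧ ∀ x ∈ Ω, |V x| ≤ Λ :=
    ⟨max Λ₀ 0, le_max_right _ _, fun x hx => (hΛ₀ x hx).trans (le_max_left _ _)⟩
  have hΩK : ∀ x, x ≠ x₀ → dist x x₀ < ρ₀ → x ∈ Ω ∧ 0 < v x ∧ v x ≤ K := fun x hx hd =>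
    have h : x ∈ Ω := ⟨mem_ball.2 (hd.trans_le hρ₀r), hx⟩
    ⟨h, hvpos x h, (hcK x ⟨mem_ball.2 hd, hx⟩).2⟩
  have : Nontrivial (Ed d) := Module.nontrivial_of_finrank_pos (R := ℝ) (by
    rw [finrank_euclideanSpace_fin]; omega)
  have : (𝓝[≠] x₀).NeBot := Module.punctured_nhds_neBot ℝ (Ed d) x₀
  have hpunct : ∀ ρ : ℝ, 0 < ρ → ∀ᶠ x in 𝓝[≠] x₀, x ≠ x₀ ∧ dist x x₀ < ρ := fun ρ hρ => by
    filter_upwards [self_mem_nhdsWithin, mem_nhdsWithin_of_mem_nhds (ball_mem_nhds x₀ hρ)]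
      with x hx hx' using ⟨hx, mem_ball.1 hx'⟩
  have hle : ∀ᶠ x in 𝓝[≠] x₀, v x ≤ K := (hpunct ρ₀ hρ₀).mono fun x hx => (hΩK x hx.1 hx.2).2.2
  have hge : ∀ᶠ x in 𝓝[≠] x₀, 0 ≤ v x :=
    (hpunct ρ₀ hρ₀).mono fun x hx => (hΩK x hx.1 hx.2).2.1.le
  have hbu : IsBoundedUnder (· ≤ ·) (𝓝[≠] x₀) v := isBoundedUnder_of_eventually_le hle
  have hbl : IsBoundedUnder (· ≥ ·) (𝓝[≠] x₀) v := isBoundedUnder_of_eventually_ge hge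
  obtain ⟨H, hH, hsphere⟩ := exists_harnack_sphere d hd hp2 hpd
  obtain ⟨C, hC, hmin⟩ := exists_sq_max_sub_le d hp2 hpd
  set L := limsup v (𝓝[≠] x₀) with hL
  refine ⟨L, tendsto_order.2 ⟨fun b hb => ?_, fun b hb => eventually_lt_of_limsup_lt hb hbu⟩⟩
  obtain ⟨ε, hε, rfl⟩ : ∃ ε : ℝ, 0 < ε ∧ b = L - ε := ⟨L - b, sub_pos.2 hb, by ring⟩
  set δ := ε / (6 * (H + 1)) with hδdef
  have hδ : 0 < δ := by positivity
  have hδε : 6 * (H + 1) * δ = ε := by rw [hδdef]; field_simp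
  have hup : ∀ᶠ x in 𝓝[≠] x₀, v x < L + δ :=
    eventually_lt_of_limsup_lt (show limsup v (𝓝[≠] x₀) < L + δ by linarith) hbu
  have hfreq : ∃ᶠ x in 𝓝[≠] x₀, L - δ < v x :=
    frequently_lt_of_lt_limsup hbl.isCoboundedUnder_le
      (show L - δ < limsup v (𝓝[≠] x₀) by linarith)
  obtain ⟨ρ₁, hρ₁, hup⟩ := Metric.mem_nhdsWithin_iff.1 hup
  have hsmall : ∀ᶠ R in 𝓝[>] (0 : ℝ), 2 * R < ρ₀ ∧ 2 * R < ρ₁ ∧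
      Λ * K ^ (p - 1) * δ ^ (1 - p) ≤ (R / 4) ^ (-p) ∧
      C * (Λ * K ^ (p - 1) * K ^ (p + 1)) ^ (1 / p) * R < (ε / 2) ^ (2 : ℝ) := by
    have h1 : Tendsto (fun R : ℝ => 2 * R) (𝓝[>] 0) (𝓝 (2 * 0)) :=
      (by fun_prop : Continuous fun R : ℝ => 2 * R).continuousAt.mono_left nhdsWithin_le_nhds
    have h2 : Tendsto (fun R : ℝ => C * (Λ * K ^ (p - 1) * K ^ (p + 1)) ^ (1 / p) * R) (𝓝[>] 0)
        (𝓝 (C * (Λ * K ^ (p - 1) * K ^ (p + 1)) ^ (1 / p) * 0)) :=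
      (continuous_const.mul continuous_id).continuousAt.mono_left nhdsWithin_le_nhds
    have h3 : Tendsto (fun R : ℝ => R / 4) (𝓝[>] 0) (𝓝[>] 0) := by
      refine tendsto_nhdsWithin_iff.2 ⟨?_, ?_⟩
      · have : Tendsto (fun R : ℝ => R / 4) (𝓝 0) (𝓝 (0 / 4)) :=
          (by fun_prop : Continuous fun R : ℝ => R / 4).continuousAt
        rw [zero_div] at this
        exact this.mono_left nhdsWithin_le_nhds
      · filter_upwards [self_mem_nhdsWithin] with R hR
          using div_pos (mem_Ioi.1 hR) four_pos
    have h4 := (tendsto_rpow_neg_nhdsGT_zero (show -p < 0 by linarith)).comp h3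
    rw [mul_zero] at h1 h2
    filter_upwards [h1.eventually_lt_const hρ₀, h1.eventually_lt_const hρ₁,
      h4.eventually_ge_atTop (Λ * K ^ (p - 1) * δ ^ (1 - p)),
      h2.eventually_lt_const (show 0 < (ε / 2) ^ (2 : ℝ) by positivity)] with R a1 a2 a3 a4
      using ⟨a1, a2, a3, a4⟩
  obtain ⟨ρ₂, hρ₂, hsmall⟩ := mem_nhdsGT_iff_exists_Ioo_subset.1 hsmall
  have hgood : ∀ ρ : ℝ, 0 < ρ → ∃ R ∈ Ioo 0 ρ, ∃ x, dist x x₀ = R ∧ L - δ < v x := fun ρ hρ => by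
    obtain ⟨x, hx, hne, hlt⟩ := (hfreq.and_eventually (hpunct ρ hρ)).exists
    exact ⟨dist x x₀, ⟨dist_pos.2 hne, hlt⟩, x, rfl, hx⟩
  have hlow : ∀ R ∈ Ioo 0 ρ₂, ∀ x, dist x x₀ = R → L - δ < v x →
      ∀ y, dist y x₀ = R → L - 3 * δ * H < v y := by
    intro R hR x hx hvx y hy
    obtain ⟨b1, b2, b3, -⟩ := hsmall hR
    have h := hsphere V Ω v Λ hsol hΩ hVm hV hv x₀ R K (L + 2 * δ) δ hR.1 hδ hΛ
      (fun z hz hzR => by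
        obtain ⟨c1, c2, c3⟩ := hΩK z hz (hzR.trans b1)
        have : v z < L + δ := hup ⟨mem_ball.2 (hzR.trans b2), hz⟩
        exact ⟨c1, c2, c3, by linarith⟩) b3 x y hx hy
    have h' : H * (L + 2 * δ - v x) ≤ H * (3 * δ) := by gcongr; linarith
    linarith
  obtain ⟨R, hR, x₁, hx₁, hvx₁⟩ := hgood ρ₂ hρ₂
  obtain ⟨b1, b2, b3, b4⟩ := hsmall hR
  filter_upwards [hpunct R hR.1] with x ⟨hxne, hxR⟩
  obtain ⟨R', hR', x₂, hx₂, hvx₂⟩ := hgood (dist x x₀) (dist_pos.2 hxne)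
  have hR'ρ₂ : R' ∈ Ioo 0 ρ₂ := ⟨hR'.1, hR'.2.trans (hxR.trans hR.2)⟩
  have hK : ∀ y, dist y x₀ ∈ Icc R' R → y ∈ Ω ∧ 0 < v y ∧ v y ≤ K := fun y hy =>
    hΩK y (dist_pos.1 (hR'.1.trans_le hy.1)) (by linarith [hy.2, hR.1])
  have hbd : ∀ y, dist y x₀ = R' ∨ dist y x₀ = R → L - 3 * δ * H < v y := by
    rintro y (hy | hy)
    · exact hlow R' hR'ρ₂ x₂ hx₂ hvx₂ y hy
    · exact hlow R hR x₁ hx₁ hvx₁ y hy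
  have hx₁K := hK x₁ (by rw [hx₁]; exact ⟨(hR'.2.trans hxR).le, le_rfl⟩)
  have h := (hmin V Ω v Λ hsol hΩ hVm hV hv x₀ R' R K (L - 3 * δ * H) hR'.1 hR.1 hΛ
    (hx₁K.2.1.le.trans hx₁K.2.2) ((hbd x₁ (Or.inr hx₁)).le.trans hx₁K.2.2) hK hbd x
    ⟨hR'.2, hxR⟩).trans_lt b4
  have h' := (Real.rpow_lt_rpow_iff (le_max_right _ _) (by positivity) two_pos).1 h
  have h'' := (le_max_left _ _).trans_lt h'
  linarith
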